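/- arXiv:2210.03312 — 4 statements merged into one kernel-verified Lean document; each statement's English description precedes it below -/
import Mathlib

section
/- Let (Ω, 𝓕, P) be a probability space, X : Ω → E a measurable map into a measurable space E, and Y : Ω → {0,1} a measurable binary label. Let p̂ : E → [0,1] be measurable and calibrated, i.e. the conditional expectation of Y given the σ-algebra generated by p̂ ∘ X equals p̂ ∘ X almost surely. Let z : E → ℝ be measurable with |z(x)| ≤ 1 for all x, and let ε ≥ 0. Define the watermarked argmax-soft label ŷ_s = 1{(p̂(X) + ε(1 + z(X)))/(1 + 2ε) > 1/2}. Then P(ŷ_s = Y) ≥ E[p̂(X)·1{p̂(X) > 1/2} + (1 − p̂(X))·1{p̂(X) ≤ 1/2}] − (1/2 + ε)·P(1/2 − ε ≤ p̂(X) ≤ 1/2 + ε). -/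
open MeasureTheory ProbabilityTheory

/-- If `q` is the conditional expectation of `Y` given `σ(q)`, then `q` and `Y` have the same
integral over every event described by `q`. -/
lemma setIntegral_preimage_eq_of_condExp_comap_eq
    {Ω : Type*} [MeasurableSpace Ω] {μ : Measure Ω} [IsFiniteMeasure μ]
    {Y q : Ω → ℝ} (hY : Integrable Y μ) (hq : Measurable q)
    (hcal : μ[Y | MeasurableSpace.comap q Real.measurableSpace] =ᵐ[μ] q)
    {s : Set ℝ} (hs : MeasurableSet s) :
    ∫ ω in q ⁻¹' s, Y ω ∂μ = ∫ ω in q ⁻¹' s, q ω ∂μ := by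
  rw [← setIntegral_condExp hq.comap_le hY ⟨s, hs, rfl⟩]
  exact setIntegral_congr_ae (hq hs) (hcal.mono fun ω h _ => h)

/-- Theorem 1 of the paper (argmax soft label case, τ = 1): if the victim's predicted
probability `p̂` is calibrated, then the accuracy of the watermarked argmax-soft label
`1{(p̂(X) + ε(1 + z(X)))/(1 + 2ε) > 1/2}` is at least the victim's accuracy
`E[p̂(X)·1{p̂(X) > 1/2} + (1 − p̂(X))·1{p̂(X) ≤ 1/2}]` minus
`(1/2 + ε)·P(1/2 − ε ≤ p̂(X) ≤ 1/2 + ε)`. -/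
theorem drw_argmax_soft_accuracy_tau_one
    {Ω : Type*} [MeasurableSpace Ω] {μ : Measure Ω} [IsProbabilityMeasure μ]
    {E : Type*} [MeasurableSpace E]
    (X : Ω → E) (hX : Measurable X)
    (Y : Ω → ℝ) (hY : Measurable Y) (hY01 : ∀ ω, Y ω = 0 ∨ Y ω = 1)
    (p : E → ℝ) (hp : Measurable p) (hp01 : ∀ x, p x ∈ Set.Icc (0 : ℝ) 1)
    (hcal : μ[Y | MeasurableSpace.comap (fun ω => p (X ω)) Real.measurableSpace]
      =ᵐ[μ] fun ω => p (X ω))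
    (z : E → ℝ) (hz : Measurable z) (hz1 : ∀ x, |z x| ≤ 1)
    (ε : ℝ) (hε : 0 ≤ ε) :
    (μ {ω | (if (p (X ω) + ε * (1 + z (X ω))) / (1 + 2 * ε) > 1 / 2 then (1 : ℝ) else 0)
        = Y ω}).toReal
      ≥ (∫ ω, (p (X ω) * (if p (X ω) > 1 / 2 then (1 : ℝ) else 0)
            + (1 - p (X ω)) * (if p (X ω) ≤ 1 / 2 then (1 : ℝ) else 0)) ∂μ)
        - (1 / 2 + ε) * (μ {ω | 1 / 2 - ε ≤ p (X ω) ∧ p (X ω) ≤ 1 / 2 + ε}).toReal := by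
  have hq : Measurable fun ω => p (X ω) := hp.comp hX
  have hzX : Measurable fun ω => z (X ω) := hz.comp hX
  have hYi : Integrable Y μ := Integrable.of_bound hY.aestronglyMeasurable 1
    (.of_forall fun ω => by rcases hY01 ω with h | h <;> simp [h])
  have hqi : Integrable (fun ω => p (X ω)) μ := Integrable.of_bound hq.aestronglyMeasurable 1
    (.of_forall fun ω => by
      rw [Real.norm_eq_abs, abs_of_nonneg (hp01 _).1]; exact (hp01 _).2)
  have hAcal := setIntegral_preimage_eq_of_condExp_comap_eq hYi hq hcal
    (measurableSet_Ioi (a := 1 / 2 + ε))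
  have hCcal := setIntegral_preimage_eq_of_condExp_comap_eq hYi hq hcal
    (measurableSet_Iio (a := 1 / 2 - ε))
  set A := (fun ω => p (X ω)) ⁻¹' Set.Ioi (1 / 2 + ε)
  set C := (fun ω => p (X ω)) ⁻¹' Set.Iio (1 / 2 - ε)
  have hA : MeasurableSet A := hq measurableSet_Ioi
  have hC : MeasurableSet C := hq measurableSet_Iio
  set B := {ω | 1 / 2 - ε ≤ p (X ω) ∧ p (X ω) ≤ 1 / 2 + ε}
  have hB : MeasurableSet B := hq measurableSet_Icc
  have mem_A (ω : Ω) : ω ∈ A ↔ 1 / 2 + ε < p (X ω) := Iff.rfl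
  have mem_C (ω : Ω) : ω ∈ C ↔ p (X ω) < 1 / 2 - ε := Iff.rfl
  have mem_B (ω : Ω) : ω ∈ B ↔ 1 / 2 - ε ≤ p (X ω) ∧ p (X ω) ≤ 1 / 2 + ε := Iff.rfl
  set S := {ω | (if (p (X ω) + ε * (1 + z (X ω))) / (1 + 2 * ε) > 1 / 2 then (1 : ℝ) else 0)
        = Y ω}
  have hS : MeasurableSet S :=
    measurableSet_eq_fun (Measurable.ite
      (measurableSet_lt measurable_const (by fun_prop)) measurable_const measurable_const) hY
  have integral_parts (f : Ω → ℝ) (hf : Integrable f μ) :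
      ∫ ω, (A.indicator f ω + C.indicator (fun ω => 1 - f ω) ω) ∂μ
        = ∫ ω in A, f ω ∂μ + (μ.real C - ∫ ω in C, f ω ∂μ) := by
    have hf' : Integrable (fun ω => 1 - f ω) μ := (integrable_const 1).sub hf
    rw [integral_add (hf.indicator hA) (hf'.indicator hC),
      integral_indicator hA, integral_indicator hC,
      integral_sub (integrable_const 1).integrableOn hf.integrableOn]
    simp
  have integrable_parts (f : Ω → ℝ) (hf : Integrable f μ) :
      Integrable (fun ω => A.indicator f ω + C.indicator (fun ω => 1 - f ω) ω) μ :=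
    (hf.indicator hA).add (((integrable_const 1).sub hf).indicator hC)
  have hcorrect : ∫ ω, (A.indicator Y ω + C.indicator (fun ω => 1 - Y ω) ω) ∂μ
      ≤ (μ S).toReal := by
    rw [← Measure.real, ← integral_indicator_one hS]
    refine integral_mono (integrable_parts Y hYi) ((integrable_const (1 : ℝ)).indicator hS)
      fun ω => ?_
    have hz' := abs_le.1 (hz1 (X ω))
    have hlabel : (p (X ω) + ε * (1 + z (X ω))) / (1 + 2 * ε) > 1 / 2
        ↔ 1 / 2 < p (X ω) + ε * z (X ω) := by
      rw [gt_iff_lt, lt_div_iff₀ (by positivity)]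
      constructor <;> intro h <;> linarith
    have hlow : -ε ≤ ε * z (X ω) := by nlinarith
    have hupp : ε * z (X ω) ≤ ε := by nlinarith
    have mem_S : ω ∈ S ↔ (if 1 / 2 < p (X ω) + ε * z (X ω) then (1 : ℝ) else 0) = Y ω := by
      simp only [← hlabel]; rfl
    classical
    simp only [Set.indicator_apply, mem_A, mem_C, mem_S, Pi.one_apply]
    clear * - hY01 hlow hupp hε
    rcases hY01 ω with h | h <;> rw [h] <;> split_ifs <;> simp_all <;> linarith
  have hvictim_le : ∀ ω, p (X ω) * (if p (X ω) > 1 / 2 then (1 : ℝ) else 0)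
        + (1 - p (X ω)) * (if p (X ω) ≤ 1 / 2 then (1 : ℝ) else 0)
      ≤ (A.indicator (fun ω => p (X ω)) ω + C.indicator (fun ω => 1 - p (X ω)) ω)
        + B.indicator (fun _ => 1 / 2 + ε) ω := fun ω => by
    classical
    simp only [Set.indicator_apply, mem_A, mem_B, mem_C, mul_ite, mul_one, mul_zero]
    clear * - hε
    grind
  have hvictim : ∫ ω, (p (X ω) * (if p (X ω) > 1 / 2 then (1 : ℝ) else 0)
        + (1 - p (X ω)) * (if p (X ω) ≤ 1 / 2 then (1 : ℝ) else 0)) ∂μ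
      ≤ ∫ ω, (A.indicator (fun ω => p (X ω)) ω + C.indicator (fun ω => 1 - p (X ω)) ω) ∂μ
        + (1 / 2 + ε) * (μ B).toReal := by
    have hBint : ∫ ω, B.indicator (fun _ => 1 / 2 + ε) ω ∂μ = (1 / 2 + ε) * (μ B).toReal := by
      rw [integral_indicator_const _ hB, smul_eq_mul, mul_comm, Measure.real]
    have hBi : Integrable (B.indicator fun _ => 1 / 2 + ε) μ := (integrable_const _).indicator hB
    rw [← hBint, ← integral_add (integrable_parts _ hqi) hBi]
    refine integral_mono_of_nonneg (.of_forall fun ω => ?_)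
      ((integrable_parts _ hqi).add hBi) (.of_forall hvictim_le)
    have h01 := hp01 (X ω)
    exact add_nonneg (mul_nonneg h01.1 (by split_ifs <;> simp))
      (mul_nonneg (sub_nonneg.2 h01.2) (by split_ifs <;> simp))
  rw [integral_parts Y hYi, hAcal, hCcal, ← integral_parts _ hqi] at hcorrect
  linarith
end

section
/- Let (Ω, 𝓕, P) be a probability space, X : Ω → E a measurable map into a measurable space E, and Y : Ω → {0,1} a measurable binary label. Let p̂ : E → [0,1] be measurable and calibrated, i.e. the conditional expectation of Y given the σ-algebra generated by p̂ ∘ X equals p̂ ∘ X almost surely. Let z : E → ℝ be measurable with |z(x)| ≤ 1 for all x, let ε ≥ 0 and τ ∈ [0,1]. Let S : Ω → {0,1} be a Bernoulli(τ) selection variable independent of the pair (X, Y). Define the output label ŷ = 1{(p̂(X) + ε(1 + z(X)))/(1 + 2ε) > 1/2} on the event {S = 1} and ŷ = 1{p̂(X) > 1/2} on the event {S = 0}. Then P(ŷ = Y) ≥ E[p̂(X)·1{p̂(X) > 1/2} + (1 − p̂(X))·1{p̂(X) ≤ 1/2}] − τ·(1/2 + ε)·P(1/2 − ε ≤ p̂(X)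 ≤ 1/2 + ε). -/
open MeasureTheory ProbabilityTheory

section Calibration

variable {Ω : Type*} [MeasurableSpace Ω] {μ : Measure Ω} [IsProbabilityMeasure μ] {Y q : Ω → ℝ}

/-- A calibrated score has the same integral as the label over every event it determines. -/
theorem setIntegral_preimage_eq_of_calibrated (hq : Measurable q) (hYi : Integrable Y μ)
    (hcal : μ[Y | MeasurableSpace.comap q Real.measurableSpace] =ᵐ[μ] q)
    {T : Set ℝ} (hT : MeasurableSet T) :
    ∫ ω in q ⁻¹' T, Y ω ∂μ = ∫ ω in q ⁻¹' T, q ω ∂μ := by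
  rw [← setIntegral_condExp hq.comap_le hYi ⟨T, hT, rfl⟩]
  exact integral_congr_ae (ae_restrict_of_ae hcal)

/-- The accuracy of the argmax label of a calibrated score, on an event the score determines. -/
theorem measureReal_argmax_correct_inter_preimage (hY : Measurable Y)
    (hY01 : ∀ ω, Y ω = 0 ∨ Y ω = 1) (hq : Measurable q) (hq01 : ∀ ω, q ω ∈ Set.Icc (0 : ℝ) 1)
    (hcal : μ[Y | MeasurableSpace.comap q Real.measurableSpace] =ᵐ[μ] q)
    {T : Set ℝ} (hT : MeasurableSet T) :
    μ.real ({ω | (if q ω > 1 / 2 then (1 : ℝ) else 0) = Y ω} ∩ q ⁻¹' T)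
      = ∫ ω in q ⁻¹' T, (q ω * (if q ω > 1 / 2 then (1 : ℝ) else 0)
          + (1 - q ω) * (if q ω ≤ 1 / 2 then (1 : ℝ) else 0)) ∂μ := by
  have hYi : Integrable Y μ := Integrable.of_bound hY.aestronglyMeasurable 1
    (.of_forall fun ω => by rcases hY01 ω with h | h <;> simp [h])
  have hqi : Integrable q μ := Integrable.of_bound hq.aestronglyMeasurable 1
    (.of_forall fun ω => abs_le.2 ⟨by linarith [(hq01 ω).1], (hq01 ω).2⟩)
  have hI : MeasurableSet {ω | q ω > 1 / 2} := measurableSet_lt measurable_const hq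
  have hJ : MeasurableSet {ω | q ω ≤ 1 / 2} := measurableSet_le hq measurable_const
  have hC : MeasurableSet {ω | (if q ω > 1 / 2 then (1 : ℝ) else 0) = Y ω} :=
    measurableSet_eq_fun (Measurable.ite hI measurable_const measurable_const) hY
  have hTq : MeasurableSet (q ⁻¹' T) := hq hT
  have hTI : MeasurableSet (T ∩ Set.Ioi (1 / 2)) := hT.inter measurableSet_Ioi
  have hTJ : MeasurableSet (T \ Set.Ioi (1 / 2)) := hT.diff measurableSet_Ioi
  have hacc : Integrable (fun ω => q ω * (if q ω > 1 / 2 then (1 : ℝ) else 0)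
      + (1 - q ω) * (if q ω ≤ 1 / 2 then (1 : ℝ) else 0)) μ := by
    refine Integrable.of_bound (Measurable.aestronglyMeasurable ?_) 1 (.of_forall fun ω => ?_)
    · exact (hq.mul (Measurable.ite hI measurable_const measurable_const)).add
        ((measurable_const.sub hq).mul (Measurable.ite hJ measurable_const measurable_const))
    · obtain ⟨h0, h1⟩ := hq01 ω
      rw [Real.norm_eq_abs, abs_le]
      split_ifs <;> constructor <;> linarith
  have hind : Integrable
      ({ω | (if q ω > 1 / 2 then (1 : ℝ) else 0) = Y ω}.indicator (1 : Ω → ℝ)) μ :=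
    (integrable_const 1).indicator hC
  have hpre : q ⁻¹' T ∩ q ⁻¹' Set.Ioi (1 / 2) = q ⁻¹' (T ∩ Set.Ioi (1 / 2)) := rfl
  have hdiff : q ⁻¹' T \ q ⁻¹' Set.Ioi (1 / 2) = q ⁻¹' (T \ Set.Ioi (1 / 2)) := rfl
  rw [← measureReal_restrict_apply hC, ← integral_indicator_one hC,
    ← integral_inter_add_sdiff (hq measurableSet_Ioi) hind.integrableOn,
    ← integral_inter_add_sdiff (hq measurableSet_Ioi) hacc.integrableOn, hpre, hdiff]
  congr 1
  · calc _ = ∫ ω in q ⁻¹' (T ∩ Set.Ioi (1 / 2)), Y ω ∂μ := by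
          refine setIntegral_congr_fun (hq hTI) fun ω hω => ?_
          have h : q ω > 1 / 2 := hω.2
          rcases hY01 ω with hy | hy <;> simp only [Set.indicator, Set.mem_ofPred_eq, h, hy] <;> simp
      _ = ∫ ω in q ⁻¹' (T ∩ Set.Ioi (1 / 2)), q ω ∂μ :=
          setIntegral_preimage_eq_of_calibrated hq hYi hcal hTI
      _ = _ := by
          refine setIntegral_congr_fun (hq hTI) fun ω hω => ?_
          have h : q ω > 1 / 2 := hω.2
          simp only [h, not_le.2 h, if_true, if_false, mul_one, mul_zero, add_zero]
  · calc _ = ∫ ω in q ⁻¹' (T \ Set.Ioi (1 / 2)), (1 - Y ω) ∂μ := by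
          refine setIntegral_congr_fun (hq hTJ) fun ω hω => ?_
          have h : ¬ q ω > 1 / 2 := hω.2
          rcases hY01 ω with hy | hy <;> simp only [Set.indicator, Set.mem_ofPred_eq, h, hy] <;> simp
      _ = ∫ ω in q ⁻¹' (T \ Set.Ioi (1 / 2)), (1 - q ω) ∂μ := by
          rw [integral_sub (integrable_const 1) hYi.integrableOn,
            integral_sub (integrable_const 1) hqi.integrableOn,
            setIntegral_preimage_eq_of_calibrated hq hYi hcal hTJ]
      _ = _ := by
          refine setIntegral_congr_fun (hq hTJ) fun ω hω => ?_
          have h : ¬ q ω > 1 / 2 := hω.2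
          simp only [h, not_lt.1 h, if_true, if_false, mul_one, mul_zero, zero_add]

/-- Within `ε` of the decision threshold, the argmax label of a calibrated score is correct with
conditional probability at most `1 / 2 + ε`. -/
theorem measureReal_argmax_correct_inter_margin_le (hY : Measurable Y)
    (hY01 : ∀ ω, Y ω = 0 ∨ Y ω = 1) (hq : Measurable q) (hq01 : ∀ ω, q ω ∈ Set.Icc (0 : ℝ) 1)
    (hcal : μ[Y | MeasurableSpace.comap q Real.measurableSpace] =ᵐ[μ] q) (ε : ℝ) :
    μ.real ({ω | (if q ω > 1 / 2 then (1 : ℝ) else 0) = Y ω}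
        ∩ q ⁻¹' Set.Icc (1 / 2 - ε) (1 / 2 + ε))
      ≤ (1 / 2 + ε) * μ.real (q ⁻¹' Set.Icc (1 / 2 - ε) (1 / 2 + ε)) := by
  rw [measureReal_argmax_correct_inter_preimage hY hY01 hq hq01 hcal measurableSet_Icc]
  refine (Real.le_norm_self _).trans
    (norm_setIntegral_le_of_norm_le_const (measure_lt_top _ _) fun ω hω => ?_)
  obtain ⟨h0, h1⟩ := hq01 ω
  obtain ⟨h2, h3⟩ := hω
  rw [Real.norm_eq_abs, abs_le]
  split_ifs <;> constructor <;> linarith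

end Calibration

/-- Perturbing a score by a signal bounded by one moves its argmax only within `ε` of the
decision threshold. -/
theorem perturbed_gt_half_iff {a ζ ε : ℝ} (hε : 0 ≤ ε) (hζ : |ζ| ≤ 1)
    (ha : a ∉ Set.Icc (1 / 2 - ε) (1 / 2 + ε)) :
    (a + ε * (1 + ζ)) / (1 + 2 * ε) > 1 / 2 ↔ a > 1 / 2 := by
  obtain ⟨h1, h2⟩ := abs_le.1 hζ
  rw [gt_iff_lt, lt_div_iff₀ (by positivity)]
  have hl : -ε ≤ ε * ζ := by nlinarith
  have hu : ε * ζ ≤ ε := by nlinarith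
  rw [Set.mem_Icc, not_and_or, not_le, not_le] at ha
  constructor <;> intro h <;> rcases ha with ha | ha <;> linarith

/-- Theorem 1, equation (6) of the paper (argmax soft label, data selection ratio τ):
each query is watermarked independently with probability τ (selection variable `S`);
on watermarked queries the argmax of the perturbed probability
`(p̂(X) + ε(1 + z(X)))/(1 + 2ε)` is returned, otherwise the victim's argmax label.
If `p̂` is calibrated, the resulting accuracy is at least
`E[p̂(X)·1{p̂(X) > 1/2} + (1 − p̂(X))·1{p̂(X) ≤ 1/2}] − τ(1/2 + ε)·P(1/2 − ε ≤ p̂(X) ≤ 1/2 + ε)`. -/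
theorem drw_argmax_soft_accuracy
    {Ω : Type*} [MeasurableSpace Ω] {μ : Measure Ω} [IsProbabilityMeasure μ]
    {E : Type*} [MeasurableSpace E]
    (X : Ω → E) (hX : Measurable X)
    (Y : Ω → ℝ) (hY : Measurable Y) (hY01 : ∀ ω, Y ω = 0 ∨ Y ω = 1)
    (p : E → ℝ) (hp : Measurable p) (hp01 : ∀ x, p x ∈ Set.Icc (0 : ℝ) 1)
    (hcal : μ[Y | MeasurableSpace.comap (fun ω => p (X ω)) Real.measurableSpace]
      =ᵐ[μ] fun ω => p (X ω))
    (z : E → ℝ) (hz : Measurable z) (hz1 : ∀ x, |z x| ≤ 1)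
    (ε : ℝ) (hε : 0 ≤ ε)
    (τ : ℝ) (hτ : τ ∈ Set.Icc (0 : ℝ) 1)
    (S : Ω → ℝ) (hS : Measurable S) (hS01 : ∀ ω, S ω = 0 ∨ S ω = 1)
    (hSτ : μ {ω | S ω = 1} = ENNReal.ofReal τ)
    (hindep : IndepFun S (fun ω => (X ω, Y ω)) μ) :
    (μ {ω | (if S ω = 1
          then (if (p (X ω) + ε * (1 + z (X ω))) / (1 + 2 * ε) > 1 / 2 then (1 : ℝ) else 0)
          else (if p (X ω) > 1 / 2 then (1 : ℝ) else 0))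
        = Y ω}).toReal
      ≥ (∫ ω, (p (X ω) * (if p (X ω) > 1 / 2 then (1 : ℝ) else 0)
            + (1 - p (X ω)) * (if p (X ω) ≤ 1 / 2 then (1 : ℝ) else 0)) ∂μ)
        - τ * (1 / 2 + ε) * (μ {ω | 1 / 2 - ε ≤ p (X ω) ∧ p (X ω) ≤ 1 / 2 + ε}).toReal := by
  set q : Ω → ℝ := fun ω => p (X ω) with hqdef
  have hq : Measurable q := hp.comp hX
  have hq01 : ∀ ω, q ω ∈ Set.Icc (0 : ℝ) 1 := fun ω => hp01 (X ω)
  set B : Set ℝ := Set.Icc (1 / 2 - ε) (1 / 2 + ε) with hB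
  set C : Set Ω := {ω | (if q ω > 1 / 2 then (1 : ℝ) else 0) = Y ω} with hC
  have hacc := measureReal_argmax_correct_inter_preimage hY hY01 hq hq01 hcal MeasurableSet.univ
  rw [Set.preimage_univ, Set.inter_univ, setIntegral_univ] at hacc
  have hmargin := measureReal_argmax_correct_inter_margin_le hY hY01 hq hq01 hcal ε
  have hsplit : μ.real ({ω | S ω = 1} ∩ (C ∩ q ⁻¹' B)) = τ * μ.real (C ∩ q ⁻¹' B) := by
    have hD : MeasurableSet {u : E × ℝ |
        (if p u.1 > 1 / 2 then (1 : ℝ) else 0) = u.2 ∧ p u.1 ∈ B} :=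
      (measurableSet_eq_fun (Measurable.ite
        (measurableSet_lt measurable_const (hp.comp measurable_fst))
        measurable_const measurable_const) measurable_snd).inter
        ((hp.comp measurable_fst) measurableSet_Icc)
    have h := hindep.measure_inter_preimage_eq_mul _ _ (measurableSet_singleton (1 : ℝ)) hD
    have h' : μ ({ω | S ω = 1} ∩ (C ∩ q ⁻¹' B)) = μ {ω | S ω = 1} * μ (C ∩ q ⁻¹' B) := h
    rw [measureReal_def, h', hSτ, ENNReal.toReal_mul, ENNReal.toReal_ofReal hτ.1, measureReal_def]
  have hsub : C ⊆ {ω | (if S ω = 1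
          then (if (p (X ω) + ε * (1 + z (X ω))) / (1 + 2 * ε) > 1 / 2 then (1 : ℝ) else 0)
          else (if p (X ω) > 1 / 2 then (1 : ℝ) else 0)) = Y ω}
        ∪ {ω | S ω = 1} ∩ (C ∩ q ⁻¹' B) := by
    intro ω hω
    by_cases hs : S ω = 1
    · by_cases hb : q ω ∈ B
      · exact Or.inr ⟨hs, hω, hb⟩
      · left
        simp only [Set.mem_ofPred_eq, if_pos hs]
        exact (if_congr (perturbed_gt_half_iff hε (hz1 (X ω)) hb) rfl rfl).trans hω
    · left
      simp only [Set.mem_ofPred_eq, if_neg hs]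
      exact hω
  have hle := (measureReal_mono (μ := μ) hsub).trans (measureReal_union_le _ _)
  rw [hsplit, hacc] at hle
  have hτm := mul_le_mul_of_nonneg_left hmargin hτ.1
  rw [← mul_assoc] at hτm
  exact sub_le_iff_le_add.2 (hle.trans (add_le_add le_rfl hτm))
end

section
/- Let (Ω, 𝓕, P) be a probability space, X : Ω → E a measurable map into a measurable space E, and Y : Ω → {0,1} a measurable binary label. Let p̂ : E → [0,1] be measurable and calibrated, i.e. the conditional expectation of Y given the σ-algebra generated by p̂ ∘ X equals p̂ ∘ X almost surely. Let z : E → ℝ be measurable with |z(x)| ≤ 1 for all x, and let ε ≥ 0. Let ŷ_h : Ω → {0,1} be a random label that is conditionally independent of Y given σ(X) and satisfies E[ŷ_h | σ(X)] = (p̂(X) + ε(1 + z(X)))/(1 + 2ε) almost surely. Then P(ŷ_h = Y) ≥ (1/(1 + 2ε)) · E[2·p̂(X)² − 2·p̂(X) + 1]. -/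
open MeasureTheory ProbabilityTheory

lemma eq_indicator_preimage_one {Ω : Type*} {f : Ω → ℝ} (hf : ∀ ω, f ω = 0 ∨ f ω = 1) :
    f = (f ⁻¹' {1}).indicator fun _ => (1 : ℝ) := by
  ext ω
  rcases hf ω with h | h <;> simp [Set.indicator, h]

lemma mul_eq_indicator_inter_preimage_one {Ω : Type*} {f g : Ω → ℝ}
    (hf : ∀ ω, f ω = 0 ∨ f ω = 1) (hg : ∀ ω, g ω = 0 ∨ g ω = 1) :
    f * g = (f ⁻¹' {1} ∩ g ⁻¹' {1}).indicator fun _ => (1 : ℝ) := by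
  ext ω
  rcases hf ω with h | h <;> rcases hg ω with h' | h' <;> simp [Set.indicator, h, h']

lemma integrable_of_measurable_of_abs_le {Ω : Type*} [MeasurableSpace Ω] {μ : Measure Ω}
    [IsFiniteMeasure μ] {f : Ω → ℝ} (hf : Measurable f) (C : ℝ) (hC : ∀ ω, |f ω| ≤ C) :
    Integrable f μ :=
  .of_bound hf.aestronglyMeasurable C (ae_of_all _ hC)

/-- Conditionally independent `{0,1}`-valued variables have multiplicative conditional mean. -/
lemma condExp_mul_of_condIndepFun_of_binary {Ω : Type*} {m mΩ : MeasurableSpace Ω}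
    [StandardBorelSpace Ω] {μ : Measure Ω} [IsFiniteMeasure μ] (hm : m ≤ mΩ) {f g : Ω → ℝ}
    (hf : Measurable f) (hg : Measurable g)
    (hf01 : ∀ ω, f ω = 0 ∨ f ω = 1) (hg01 : ∀ ω, g ω = 0 ∨ g ω = 1)
    (h : CondIndepFun m hm f g μ) :
    μ[f * g | m] =ᵐ[μ] μ[f | m] * μ[g | m] := by
  have key := (condIndepFun_iff_condExp_inter_preimage_eq_mul hf hg).1 h {1} {1}
    (measurableSet_singleton 1) (measurableSet_singleton 1)
  rw [← mul_eq_indicator_inter_preimage_one hf01 hg01, ← eq_indicator_preimage_one hf01,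
    ← eq_indicator_preimage_one hg01] at key
  exact key

/-- The conditional mean can be replaced by the variable under the integral, against a bounded
measurable weight. -/
lemma integral_mul_eq_integral_mul_condExp {Ω : Type*} {m mΩ : MeasurableSpace Ω}
    {μ : Measure Ω} [IsFiniteMeasure μ] (hm : m ≤ mΩ) {f g : Ω → ℝ}
    (hf : Measurable[m] f) (hg : Integrable g μ) (C : ℝ) (hC : ∀ ω, |f ω| ≤ C) :
    ∫ ω, f ω * g ω ∂μ = ∫ ω, f ω * (μ[g | m]) ω ∂μ := by
  rw [← integral_condExp hm]
  exact integral_congr_ae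
    (condExp_stronglyMeasurable_mul_of_bound hm hf.stronglyMeasurable hg C (ae_of_all _ hC))

lemma integrable_two_mul_sub_sub_add_one {Ω : Type*} [MeasurableSpace Ω] {μ : Measure Ω}
    [IsFiniteMeasure μ] {u v w : Ω → ℝ}
    (hu : Integrable u μ) (hv : Integrable v μ) (hw : Integrable w μ) :
    Integrable (fun ω => 2 * u ω - v ω - w ω + 1) μ := by
  fun_prop

lemma integral_two_mul_sub_sub_add_one {Ω : Type*} [MeasurableSpace Ω] {μ : Measure Ω}
    [IsProbabilityMeasure μ] {u v w : Ω → ℝ}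
    (hu : Integrable u μ) (hv : Integrable v μ) (hw : Integrable w μ) :
    ∫ ω, (2 * u ω - v ω - w ω + 1) ∂μ
      = 2 * ∫ ω, u ω ∂μ - ∫ ω, v ω ∂μ - ∫ ω, w ω ∂μ + 1 := by
  rw [integral_add (by fun_prop) (by fun_prop), integral_sub (by fun_prop) (by fun_prop),
    integral_sub (by fun_prop) (by fun_prop), integral_const_mul]
  simp

theorem drw_sampling_hard_accuracy_tau_one
    {Ω : Type*} [MeasurableSpace Ω] [StandardBorelSpace Ω]
    {μ : Measure Ω} [IsProbabilityMeasure μ]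
    {E : Type*} [MeasurableSpace E]
    (X : Ω → E) (hX : Measurable X)
    (Y : Ω → ℝ) (hY : Measurable Y) (hY01 : ∀ ω, Y ω = 0 ∨ Y ω = 1)
    (p : E → ℝ) (hp : Measurable p) (hp01 : ∀ x, p x ∈ Set.Icc (0 : ℝ) 1)
    (hcal : μ[Y | MeasurableSpace.comap (fun ω => p (X ω)) Real.measurableSpace]
      =ᵐ[μ] fun ω => p (X ω))
    (z : E → ℝ) (hz : Measurable z) (hz1 : ∀ x, |z x| ≤ 1)
    (ε : ℝ) (hε : 0 ≤ ε)
    (yh : Ω → ℝ) (hyh : Measurable yh) (hyh01 : ∀ ω, yh ω = 0 ∨ yh ω = 1)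
    (hci : CondIndepFun (MeasurableSpace.comap X inferInstance) hX.comap_le yh Y μ)
    (hmean : μ[yh | MeasurableSpace.comap X inferInstance]
      =ᵐ[μ] fun ω => (p (X ω) + ε * (1 + z (X ω))) / (1 + 2 * ε)) :
    (μ {ω | yh ω = Y ω}).toReal
      ≥ (1 / (1 + 2 * ε)) * ∫ ω, (2 * p (X ω) ^ 2 - 2 * p (X ω) + 1) ∂μ := by
  have hpos : 0 < 1 + 2 * ε := by positivity
  set a : E → ℝ := fun x => (p x + ε * (1 + z x)) / (1 + 2 * ε) with ha
  have ham : Measurable a := by fun_prop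
  have ha1 : ∀ x, |a x| ≤ 1 := fun x => by
    have h1 := abs_le.1 (hz1 x)
    obtain ⟨h2, h3⟩ := hp01 x
    have h4 : 0 ≤ p x + ε * (1 + z x) := add_nonneg h2 (mul_nonneg hε (by linarith))
    rw [abs_of_nonneg (div_nonneg h4 hpos.le), div_le_one hpos]
    nlinarith
  have abs_binary : ∀ y : ℝ, y = 0 ∨ y = 1 → |y| ≤ 1 := by
    rintro y (rfl | rfl) <;> simp
  have abs_mul_le : ∀ x y : ℝ, |x| ≤ 1 → |y| ≤ 1 → |x * y| ≤ 1 := fun x y hx hy => by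
    rw [abs_mul]
    exact mul_le_one₀ hx (abs_nonneg y) hy
  have hp1 : ∀ x, |p x| ≤ 1 := fun x => abs_le.2 ⟨by linarith [(hp01 x).1], (hp01 x).2⟩
  have hY1 := fun ω => abs_binary _ (hY01 ω)
  have hyh1 := fun ω => abs_binary _ (hyh01 ω)
  have iY : Integrable Y μ := integrable_of_measurable_of_abs_le hY 1 hY1
  have iyh : Integrable yh μ := integrable_of_measurable_of_abs_le hyh 1 hyh1
  have ip : Integrable (fun ω => p (X ω)) μ :=
    integrable_of_measurable_of_abs_le (by fun_prop) 1 fun ω => hp1 _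
  have ia : Integrable (fun ω => a (X ω)) μ :=
    integrable_of_measurable_of_abs_le (by fun_prop) 1 fun ω => ha1 _
  have iyhY : Integrable (fun ω => yh ω * Y ω) μ :=
    integrable_of_measurable_of_abs_le (by fun_prop) 1 fun ω => abs_mul_le _ _ (hyh1 _) (hY1 _)
  have iaY : Integrable (fun ω => a (X ω) * Y ω) μ :=
    integrable_of_measurable_of_abs_le (by fun_prop) 1 fun ω => abs_mul_le _ _ (ha1 _) (hY1 _)
  have ipY : Integrable (fun ω => p (X ω) * Y ω) μ :=
    integrable_of_measurable_of_abs_le (by fun_prop) 1 fun ω => abs_mul_le _ _ (hp1 _) (hY1 _)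
  have ipp : Integrable (fun ω => p (X ω) * p (X ω)) μ :=
    integrable_of_measurable_of_abs_le (by fun_prop) 1 fun ω => abs_mul_le _ _ (hp1 _) (hp1 _)
  have hpX : Measurable fun ω => p (X ω) := hp.comp hX
  have int_yh : ∫ ω, yh ω ∂μ = ∫ ω, a (X ω) ∂μ := by
    rw [← integral_condExp hX.comap_le]
    exact integral_congr_ae hmean
  have int_Y : ∫ ω, Y ω ∂μ = ∫ ω, p (X ω) ∂μ := by
    rw [← integral_condExp hpX.comap_le]
    exact integral_congr_ae hcal
  have int_yhY : ∫ ω, yh ω * Y ω ∂μ = ∫ ω, a (X ω) * Y ω ∂μ := by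
    rw [integral_mul_eq_integral_mul_condExp (f := fun ω => a (X ω)) hX.comap_le
      (ham.comp (comap_measurable X)) iY 1 fun ω => ha1 _, ← integral_condExp hX.comap_le]
    refine integral_congr_ae ?_
    filter_upwards [condExp_mul_of_condIndepFun_of_binary hX.comap_le hyh hY hyh01 hY01 hci,
      hmean] with ω h1 h2
    exact h1.trans (congrArg (· * _) h2)
  have int_pY : ∫ ω, p (X ω) * Y ω ∂μ = ∫ ω, p (X ω) * p (X ω) ∂μ := by
    rw [integral_mul_eq_integral_mul_condExp (f := fun ω => p (X ω)) hpX.comap_le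
      (comap_measurable fun ω => p (X ω)) iY 1 fun ω => hp1 _]
    refine integral_congr_ae ?_
    filter_upwards [hcal] with ω h
    rw [h]
  have prob_eq : (μ {ω | yh ω = Y ω}).toReal
      = ∫ ω, (2 * (yh ω * Y ω) - yh ω - Y ω + 1) ∂μ := by
    have hind : (fun ω => 2 * (yh ω * Y ω) - yh ω - Y ω + 1)
        = {ω | yh ω = Y ω}.indicator 1 := by
      ext ω
      rcases hyh01 ω with h | h <;> rcases hY01 ω with h' | h' <;>
        norm_num [Set.indicator, h, h']
    rw [hind, integral_indicator_one (measurableSet_eq_fun hyh hY)]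
    rfl
  have agree_eq : ∫ ω, (2 * (yh ω * Y ω) - yh ω - Y ω + 1) ∂μ
      = ∫ ω, (2 * (a (X ω) * Y ω) - a (X ω) - Y ω + 1) ∂μ := by
    rw [integral_two_mul_sub_sub_add_one iyhY iyh iY,
      integral_two_mul_sub_sub_add_one iaY ia iY, int_yhY, int_yh]
  have clean_eq : ∫ ω, (2 * p (X ω) ^ 2 - 2 * p (X ω) + 1) ∂μ
      = ∫ ω, (2 * (p (X ω) * Y ω) - p (X ω) - Y ω + 1) ∂μ := by
    rw [integral_two_mul_sub_sub_add_one ipY ip iY, int_pY, int_Y,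
      ← integral_two_mul_sub_sub_add_one ipp ip ip]
    congr with ω
    ring
  rw [ge_iff_le, prob_eq, agree_eq, clean_eq, ← integral_const_mul]
  refine integral_mono ((integrable_two_mul_sub_sub_add_one ipY ip iY).const_mul _)
    (integrable_two_mul_sub_sub_add_one iaY ia iY) fun ω => ?_
  have hzω := abs_le.1 (hz1 (X ω))
  have signal_nonneg : 0 ≤ 2 * z (X ω) * Y ω + 1 - z (X ω) := by
    rcases hY01 ω with h | h <;> rw [h] <;> linarith
  have expand : 2 * (a (X ω) * Y ω) - a (X ω) - Y ω + 1
      = 1 / (1 + 2 * ε) * (2 * (p (X ω) * Y ω) - p (X ω) - Y ω + 1)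
        + ε * (2 * z (X ω) * Y ω + 1 - z (X ω)) / (1 + 2 * ε) := by
    simp only [ha]
    field_simp
    ring
  simp only [expand]
  exact le_add_of_nonneg_right (by positivity)
end

section
/- Let (Ω, 𝓕, P) be a probability space, X : Ω → E a measurable map into a measurable space E, and Y : Ω → {0,1} a measurable binary label. Let p̂ : E → [0,1] be measurable and calibrated, i.e. the conditional expectation of Y given the σ-algebra generated by p̂ ∘ X equals p̂ ∘ X almost surely. Then E[p̂(X)·Y + (1 − p̂(X))·(1 − Y)] = E[2·p̂(X)² − 2·p̂(X) + 1]. -/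
open MeasureTheory ProbabilityTheory

/-- If `Z` is a version of the conditional expectation of `Y` given `m`, then `Y` may be replaced
by `Z` in the integral against an `m`-measurable function. -/
theorem integral_mul_eq_of_condExp_ae_eq {Ω : Type*} {m mΩ : MeasurableSpace Ω} {μ : Measure Ω}
    (hm : m ≤ mΩ) [SigmaFinite (μ.trim hm)] {f Y Z : Ω → ℝ} (hf : StronglyMeasurable[m] f)
    (hfY : Integrable (f * Y) μ) (hY : Integrable Y μ) (hZ : μ[Y | m] =ᵐ[μ] Z) :
    ∫ ω, f ω * Y ω ∂μ = ∫ ω, f ω * Z ω ∂μ := by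
  calc ∫ ω, f ω * Y ω ∂μ = ∫ ω, (μ[f * Y | m]) ω ∂μ := (integral_condExp hm).symm
    _ = ∫ ω, f ω * Z ω ∂μ := by
      refine integral_congr_ae ?_
      filter_upwards [condExp_mul_of_stronglyMeasurable_left hf hfY hY, hZ] with ω h₁ h₂
      rw [h₁, Pi.mul_apply, h₂]

/-- Term A in the proof of Theorem 1 (sampling hard label case) of the paper:
if `p̂` is calibrated, then the agreement probability of a Bernoulli(p̂(X)) sample with
the true label, `E[p̂(X)·Y + (1 − p̂(X))·(1 − Y)]`, equals `E[2p̂(X)² − 2p̂(X) + 1]`. -/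
theorem drw_term_A_identity
    {Ω : Type*} [MeasurableSpace Ω] {μ : Measure Ω} [IsProbabilityMeasure μ]
    {E : Type*} [MeasurableSpace E]
    (X : Ω → E) (hX : Measurable X)
    (Y : Ω → ℝ) (hY : Measurable Y) (hY01 : ∀ ω, Y ω = 0 ∨ Y ω = 1)
    (p : E → ℝ) (hp : Measurable p) (hp01 : ∀ x, p x ∈ Set.Icc (0 : ℝ) 1)
    (hcal : μ[Y | MeasurableSpace.comap (fun ω => p (X ω)) Real.measurableSpace]
      =ᵐ[μ] fun ω => p (X ω)) :
    ∫ ω, (p (X ω) * Y ω + (1 - p (X ω)) * (1 - Y ω)) ∂μ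
      = ∫ ω, (2 * p (X ω) ^ 2 - 2 * p (X ω) + 1) ∂μ := by
  have hpX : Measurable fun ω => p (X ω) := hp.comp hX
  have hm := hpX.comap_le
  have hpm : Measurable[MeasurableSpace.comap (fun ω => p (X ω)) Real.measurableSpace]
      fun ω => p (X ω) := comap_measurable _
  have hpint : Integrable (fun ω => p (X ω)) μ :=
    .of_mem_Icc 0 1 hpX.aemeasurable (.of_forall fun ω => hp01 (X ω))
  have hYint : Integrable Y μ :=
    .of_mem_Icc 0 1 hY.aemeasurable (.of_forall fun ω => by rcases hY01 ω with h | h <;> simp [h])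
  have hfbound : ∀ᵐ ω ∂μ, ‖2 * p (X ω) - 1‖ ≤ 1 := .of_forall fun ω => by
    obtain ⟨h₀, h₁⟩ := hp01 (X ω)
    rw [Real.norm_eq_abs, abs_le]
    constructor <;> linarith
  have hfmeas : AEStronglyMeasurable (fun ω => 2 * p (X ω) - 1) μ :=
    ((hpX.const_mul 2).sub_const 1).aestronglyMeasurable
  have hfY : Integrable (fun ω => (2 * p (X ω) - 1) * Y ω) μ := hYint.bdd_mul hfmeas hfbound
  have hfp : Integrable (fun ω => (2 * p (X ω) - 1) * p (X ω)) μ := hpint.bdd_mul hfmeas hfbound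
  have hrest : Integrable (fun ω => 1 - p (X ω)) μ := (integrable_const 1).sub hpint
  calc ∫ ω, (p (X ω) * Y ω + (1 - p (X ω)) * (1 - Y ω)) ∂μ
      = ∫ ω, ((2 * p (X ω) - 1) * Y ω + (1 - p (X ω))) ∂μ := by
        congr with ω
        ring
    _ = ∫ ω, ((2 * p (X ω) - 1) * p (X ω) + (1 - p (X ω))) ∂μ := by
        rw [integral_add hfY hrest, integral_add hfp hrest, integral_mul_eq_of_condExp_ae_eq hm
          ((hpm.const_mul 2).sub_const 1).stronglyMeasurable hfY hYint hcal]
    _ = ∫ ω, (2 * p (X ω) ^ 2 - 2 * p (X ω) + 1) ∂μ := by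
        congr with ω
        ring
end
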